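/- arXiv:1012.4514 — 2 statements merged into one kernel-verified Lean document; each statement's English description precedes it below -/
import Mathlib

section
/- Let T be a contraction on an n-dimensional Hilbert space H and N a positive integer. Then there exists a Hilbert space K containing H with dim K = n + N·d_T (where d_T = rank(I - T*T)^{1/2}) and a unitary U on K such that T^k = P_H U^k P_H for all k = 1, ..., N. -/
open ContinuousLinearMap

section Dilation

variable {H R : Type*} [NormedAddCommGroup H] [InnerProductSpace ℂ H]
  [NormedAddCommGroup R] [InnerProductSpace ℂ R]

/-- The model space `H ⊕ R ⊕ ⋯ ⊕ R` with `m` copies of the defect space `R`. -/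
abbrev DilationSpace (H R : Type*) (m : ℕ) : Type _ :=
  WithLp 2 (H × PiLp 2 (fun _ : Fin m => R))

theorem DilationSpace.norm_sq {H R : Type*} [NormedAddCommGroup H] [NormedAddCommGroup R]
    {m : ℕ} (x : DilationSpace H R m) :
    ‖x‖ ^ 2 = ‖x.fst‖ ^ 2 + ∑ i, ‖x.snd i‖ ^ 2 := by
  rw [WithLp.prod_norm_sq_eq_of_L2, PiLp.norm_sq_eq_of_L2]

/-- The isometry `(h, r₀, …, rₘ₋₁) ↦ (h, r₀, …, rₘ₋₁, 0)`. -/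
noncomputable def dilationPad (H R : Type*) [NormedAddCommGroup H] [InnerProductSpace ℂ H]
    [NormedAddCommGroup R] [InnerProductSpace ℂ R] (m : ℕ) :
    DilationSpace H R m →ₗᵢ[ℂ] DilationSpace H R (m + 1) where
  toFun x := WithLp.toLp 2 (x.fst, WithLp.toLp 2 (Fin.snoc (α := fun _ => R) x.snd 0))
  map_add' x y := by
    refine WithLp.ofLp_injective 2 (Prod.ext (by simp) (PiLp.ext fun i => ?_))
    refine Fin.lastCases ?_ (fun j => ?_) i <;> simp
  map_smul' c x := by
    refine WithLp.ofLp_injective 2 (Prod.ext (by simp) (PiLp.ext fun i => ?_))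
    refine Fin.lastCases ?_ (fun j => ?_) i <;> simp
  norm_map' x := by
    refine (sq_eq_sq₀ (norm_nonneg _) (norm_nonneg _)).1 ?_
    simp [DilationSpace.norm_sq, Fin.sum_univ_castSucc]

/-- The isometry `(h, r₀, …, rₘ₋₁) ↦ (T h, D h, r₀, …, rₘ₋₁)`. -/
noncomputable def dilationShift (T : H →ₗ[ℂ] H) (D : H →ₗ[ℂ] R)
    (hTD : ∀ h, ‖T h‖ ^ 2 + ‖D h‖ ^ 2 = ‖h‖ ^ 2) (m : ℕ) :
    DilationSpace H R m →ₗᵢ[ℂ] DilationSpace H R (m + 1) where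
  toFun x := WithLp.toLp 2
    (T x.fst, WithLp.toLp 2 (Fin.cons (α := fun _ => R) (D x.fst) x.snd))
  map_add' x y := by
    refine WithLp.ofLp_injective 2 (Prod.ext (by simp) (PiLp.ext fun i => ?_))
    refine Fin.cases ?_ (fun j => ?_) i <;> simp
  map_smul' c x := by
    refine WithLp.ofLp_injective 2 (Prod.ext (by simp) (PiLp.ext fun i => ?_))
    refine Fin.cases ?_ (fun j => ?_) i <;> simp
  norm_map' x := by
    refine (sq_eq_sq₀ (norm_nonneg _) (norm_nonneg _)).1 ?_
    simp [DilationSpace.norm_sq, Fin.sum_univ_succ, ← add_assoc, hTD]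

/-- The isometric embedding of `H` as the first summand. -/
noncomputable def dilationInl (H R : Type*) [NormedAddCommGroup H] [InnerProductSpace ℂ H]
    [NormedAddCommGroup R] [InnerProductSpace ℂ R] (m : ℕ) :
    H →ₗᵢ[ℂ] DilationSpace H R m where
  toFun h := WithLp.toLp 2 (h, 0)
  map_add' x y := WithLp.ofLp_injective 2 (by simp)
  map_smul' c x := WithLp.ofLp_injective 2 (by simp)
  norm_map' x := by simp

theorem finrank_dilationSpace [FiniteDimensional ℂ H] [FiniteDimensional ℂ R] (m : ℕ) :
    Module.finrank ℂ (DilationSpace H R m) =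
      Module.finrank ℂ H + m * Module.finrank ℂ R := by
  rw [(WithLp.linearEquiv 2 ℂ (H × PiLp 2 (fun _ : Fin m => R))).finrank_eq,
    Module.finrank_prod, (WithLp.linearEquiv 2 ℂ (Fin m → R)).finrank_eq]
  simp [Module.finrank_pi_fintype]

end Dilation

/-- In finite dimension, two isometries with the same domain and codomain differ by a unitary. -/
theorem LinearIsometry.exists_unitary_apply_eq {A V : Type*}
    [NormedAddCommGroup A] [InnerProductSpace ℂ A]
    [NormedAddCommGroup V] [InnerProductSpace ℂ V] [FiniteDimensional ℂ V]
    (J S : A →ₗᵢ[ℂ] V) :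
    ∃ U : V →L[ℂ] V, U ∈ unitary (V →L[ℂ] V) ∧ ∀ a, U (J a) = S a := by
  let L := S.comp J.equivRange.symm.toLinearIsometry
  let E := L.extend.toLinearIsometryEquiv rfl
  refine ⟨(Unitary.linearIsometryEquiv.symm E : unitary (V →L[ℂ] V)), Subtype.prop _,
    fun a => ?_⟩
  have h := L.extend_apply (J.equivRange a)
  simpa [L, E] using h

/-- **Existence of unitary N-dilations (Egerváry).** Every contraction `T` on an
`n`-dimensional complex Hilbert space `H` has a unitary `N`-dilation acting on a Hilbert
space `K ⊇ H` of dimension `n + N·d_T`, where `d_T = rank (I - T*T)^{1/2}`: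
there are an isometric embedding `W : H → K` and a unitary `U` on `K` such that
`T^k = P_H U^k P_H` (equivalently `W* U^k W = T^k`) for all `k = 1, …, N`. -/
theorem exists_unitary_N_dilation
    (H : Type) [NormedAddCommGroup H] [InnerProductSpace ℂ H] [FiniteDimensional ℂ H]
    (n : ℕ) (hn : Module.finrank ℂ H = n)
    (T D : H →L[ℂ] H) (hT : ‖T‖ ≤ 1)
    (hD_pos : D.IsPositive) (hD_sq : D * D = 1 - adjoint T * T)
    (N : ℕ) (hN : 0 < N) :
    ∃ (W : H →ₗᵢ[ℂ] EuclideanSpace ℂ (Fin (n + N * Module.finrank ℂ (LinearMap.range D.toLinearMap))))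
      (U : EuclideanSpace ℂ (Fin (n + N * Module.finrank ℂ (LinearMap.range D.toLinearMap))) →L[ℂ]
           EuclideanSpace ℂ (Fin (n + N * Module.finrank ℂ (LinearMap.range D.toLinearMap)))),
      U ∈ unitary _ ∧
      ∀ k : ℕ, 1 ≤ k → k ≤ N →
        ∀ h : H, adjoint W.toContinuousLinearMap ((U ^ k) (W h)) = (T ^ k) h := by
  obtain ⟨m, rfl⟩ : ∃ m, N = m + 1 := ⟨N - 1, by omega⟩
  set R := LinearMap.range D.toLinearMap
  have hTD : ∀ h, ‖T.toLinearMap h‖ ^ 2 + ‖D.toLinearMap.rangeRestrict h‖ ^ 2 = ‖h‖ ^ 2 := by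
    intro h
    have h1 : inner ℂ h ((D * D) h) = inner ℂ h ((1 - adjoint T * T) h) := by rw [hD_sq]
    have h2 : inner ℂ (D h) (D h) = inner ℂ h h - inner ℂ (T h) (T h) := by
      refine (hD_pos.isSelfAdjoint.isSymmetric h (D h)).trans ?_
      simpa [inner_sub_right, adjoint_inner_right] using h1
    have h3 := congrArg Complex.re h2
    have h4 : ∀ x : H, (inner ℂ x x).re = ‖x‖ ^ 2 := fun x => inner_self_eq_norm_sq (𝕜 := ℂ) x
    rw [Complex.sub_re, h4, h4, h4] at h3
    change ‖T h‖ ^ 2 + ‖D h‖ ^ 2 = ‖h‖ ^ 2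
    linarith
  let E := ((stdOrthonormalBasis ℂ (DilationSpace H R (m + 1))).reindex
    (finCongr ((finrank_dilationSpace (m + 1)).trans (by rw [hn])))).repr
  obtain ⟨U, hU, hUJ⟩ := LinearIsometry.exists_unitary_apply_eq
    (E.toLinearIsometry.comp (dilationPad H R m))
    (E.toLinearIsometry.comp (dilationShift T.toLinearMap D.toLinearMap.rangeRestrict hTD m))
  refine ⟨E.toLinearIsometry.comp (dilationInl H R (m + 1)), U, hU, fun k _ hk h => ?_⟩
  have key : ∀ k ≤ m + 1, ∃ r : PiLp 2 (fun _ : Fin (m + 1) => R),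
      (U ^ k) (E (dilationInl H R (m + 1) h)) = E (WithLp.toLp 2 ((T ^ k) h, r)) ∧
        ∀ i : Fin (m + 1), k ≤ i → r i = 0 := by
    intro k
    induction k with
    | zero => exact fun _ => ⟨0, rfl, fun _ _ => rfl⟩
    | succ k ih =>
      intro hk
      obtain ⟨r, hr, hr0⟩ := ih (by omega)
      let a : DilationSpace H R m :=
        WithLp.toLp 2 ((T ^ k) h, WithLp.toLp 2 fun i => r i.castSucc)
      have ha : dilationPad H R m a = WithLp.toLp 2 ((T ^ k) h, r) := by
        refine WithLp.ofLp_injective 2 (Prod.ext rfl (PiLp.ext fun i => ?_))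
        refine Fin.lastCases ?_ (fun j => ?_) i
        · simp [dilationPad, hr0 (Fin.last m) (by simp; omega)]
        · simp [dilationPad, a]
      refine ⟨(dilationShift T.toLinearMap D.toLinearMap.rangeRestrict hTD m a).snd, ?_, ?_⟩
      · rw [pow_succ', mul_apply_eq_comp, hr, ← ha]
        refine (hUJ a).trans (congrArg E ?_)
        rw [pow_succ']
        rfl
      · intro i
        refine Fin.cases (fun hi => ?_) (fun j hi => ?_) i
        · simp at hi
        · exact hr0 j.castSucc (by simpa using hi)
  obtain ⟨r, hr, -⟩ := key k hk
  refine ext_inner_left ℂ fun x => ?_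
  rw [adjoint_inner_right]
  change inner ℂ (E (dilationInl H R (m + 1) x))
    ((U ^ k) (E (dilationInl H R (m + 1) h))) = _
  rw [hr, E.inner_map_map]
  simp [dilationInl, WithLp.prod_inner_apply]
end

section
/- Let T_1, ..., T_k be doubly commuting contractions on an n-dimensional Hilbert space H (T_i commutes with T_j and T_j* for all i ≠ j). Then for every N there exist commuting unitaries U_1, ..., U_k on a Hilbert space K ⊇ H of dimension (N+1)^k · n such that T_1^{m_1} ⋯ T_k^{m_k} = P_H U_1^{m_1} ⋯ U_k^{m_k} P_H whenever m_1 + ⋯ + m_k ≤ N. -/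
open ContinuousLinearMap

section DefectOperators

variable {A : Type*} [CStarAlgebra A] [PartialOrder A] [StarOrderedRing A]

/-- Nonnegative square roots inherit intertwining relations from their squares. -/
theorem mul_eq_mul_of_nonneg_of_mul_self_mul_eq {d e t : A} (hd : 0 ≤ d) (he : 0 ≤ e)
    (h : e * e * t = t * (d * d)) : e * t = t * d := by
  have hds : star d = d := (IsSelfAdjoint.of_nonneg hd).star_eq
  have hes : star e = e := (IsSelfAdjoint.of_nonneg he).star_eq
  obtain ⟨x, hx⟩ : ∃ x, x = e * t - t * d := ⟨_, rfl⟩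
  have hex : e * x = -(x * d) := by
    rw [hx, mul_sub, sub_mul, ← mul_assoc, h]
    noncomm_ring
  have hxe : star x * e = -(d * star x) := by
    simpa [hds, hes] using congrArg star hex
  have hPd : star x * e * x = -(star x * x * d) := by
    rw [mul_assoc, hex, mul_neg, mul_assoc]
  have hdP : star x * e * x = -(d * (star x * x)) := by
    rw [hxe, neg_mul, mul_assoc]
  have hcomm : Commute (star x * x) d := neg_injective (hPd.symm.trans hdP)
  have h1 : 0 ≤ star x * x * d := hcomm.mul_nonneg (star_mul_self_nonneg x) hd
  have h2 : 0 ≤ star x * e * x := star_left_conjugate_nonneg he x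
  have hPd0 : star x * x * d = 0 := le_antisymm (by rw [hPd] at h2; simpa using h2) h1
  have hxd : x * d = 0 := by
    rw [← CStarRing.star_mul_self_eq_zero_iff, star_mul, hds, mul_assoc, ← mul_assoc (star x),
      hPd0, mul_zero]
  have hdx : d * star x = 0 := by simpa [hds] using congrArg star hxd
  have hxe0 : star x * e = 0 := by rw [hxe, hdx, neg_zero]
  have hP : star x * x = -(star x * t * d) := by
    nth_rewrite 2 [hx]
    rw [mul_sub, ← mul_assoc, hxe0, zero_mul, zero_sub, mul_assoc]
  have hPP : star (star x * x) * (star x * x) = 0 := by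
    rw [(IsSelfAdjoint.star_mul_self x).star_eq]
    nth_rewrite 1 [hP]
    rw [neg_mul, mul_assoc, ← mul_assoc d, hdx, zero_mul, mul_zero, neg_zero]
  rw [CStarRing.star_mul_self_eq_zero_iff, CStarRing.star_mul_self_eq_zero_iff, hx,
    sub_eq_zero] at hPP
  exact hPP

theorem exists_nonneg_sqrt_one_sub_star_mul_self {t : A} (ht : ‖t‖ ≤ 1) :
    ∃ d : A, 0 ≤ d ∧ d * d = 1 - star t * t ∧
      ∀ s, Commute s t → Commute s (star t) → Commute s d := by
  have h : 0 ≤ 1 - star t * t := by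
    rw [sub_nonneg, ← CStarAlgebra.norm_le_one_iff_of_nonneg (star t * t) (star_mul_self_nonneg t),
      CStarRing.norm_star_mul_self]
    exact mul_le_one₀ ht (norm_nonneg _) ht
  refine ⟨CFC.sqrt (1 - star t * t), CFC.sqrt_nonneg _, CFC.sqrt_mul_sqrt_self _ h, ?_⟩
  intro s h1 h2
  exact (Commute.cfcₙ_nnreal ((Commute.one_left s).sub_left (h2.mul_right h1).symm) _).symm

/-- The defect elements `d` and `e` of a contraction `t`. -/
theorem exists_defects {t : A} (ht : ‖t‖ ≤ 1) :
    ∃ d e : A, star d = d ∧ star e = e ∧ d * d = 1 - star t * t ∧ e * e = 1 - t * star t ∧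
      e * t = t * d ∧
      ∀ s, Commute s t → Commute s (star t) → Commute s d ∧ Commute s e := by
  obtain ⟨d, hd, hdd, hdc⟩ := exists_nonneg_sqrt_one_sub_star_mul_self ht
  obtain ⟨e, he, hee, hec⟩ :=
    exists_nonneg_sqrt_one_sub_star_mul_self (t := star t) (by rwa [norm_star])
  rw [star_star] at hee hec
  refine ⟨d, e, (IsSelfAdjoint.of_nonneg hd).star_eq, (IsSelfAdjoint.of_nonneg he).star_eq,
    hdd, hee, mul_eq_mul_of_nonneg_of_mul_self_mul_eq hd he ?_,
    fun s h1 h2 => ⟨hdc s h1 h2, hec s h2 h1⟩⟩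
  rw [hdd, hee]
  noncomm_ring

end DefectOperators

section LinearIsometry

variable {E F G : Type*} [NormedAddCommGroup E] [InnerProductSpace ℂ E] [CompleteSpace E]
  [NormedAddCommGroup F] [InnerProductSpace ℂ F] [CompleteSpace F]
  [NormedAddCommGroup G] [InnerProductSpace ℂ G] [CompleteSpace G]

theorem adjoint_linearIsometry_comp_apply (V : F →ₗᵢ[ℂ] G) (W : E →ₗᵢ[ℂ] F) (x : G) :
    adjoint (V.comp W).toContinuousLinearMap x =
      adjoint W.toContinuousLinearMap (adjoint V.toContinuousLinearMap x) :=
  ext_inner_right ℂ fun y => by simp [adjoint_inner_left]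

theorem adjoint_linearIsometry_apply_self (V : E →ₗᵢ[ℂ] F) (x : E) :
    adjoint V.toContinuousLinearMap (V x) = x :=
  ext_inner_right ℂ fun y => by simp [adjoint_inner_left]

end LinearIsometry

section Dilation

variable {H : Type*} [NormedAddCommGroup H] [InnerProductSpace ℂ H] [FiniteDimensional ℂ H]

/-- The operator acting as `A` on every coordinate of a finite direct sum of copies of `H`. -/
noncomputable def diagonalOperator (H ι : Type*) [NormedAddCommGroup H]
    [InnerProductSpace ℂ H] [FiniteDimensional ℂ H] [Fintype ι] :
    (H →L[ℂ] H) →⋆ₐ[ℂ] (PiLp 2 (fun _ : ι => H) →L[ℂ] PiLp 2 (fun _ : ι => H)) where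
  toFun A := LinearMap.toContinuousLinearMap
    { toFun := fun x => WithLp.toLp 2 fun i => A (x i)
      map_add' := fun x y => by ext i; simp
      map_smul' := fun c x => by ext i; simp }
  map_one' := by ext; simp
  map_mul' A B := by ext; simp
  map_zero' := by ext; simp
  map_add' A B := by ext; simp
  commutes' r := by ext; simp [Algebra.algebraMap_eq_smul_one]
  map_star' A := by
    refine ContinuousLinearMap.ext fun x => ext_inner_right ℂ fun y => ?_
    simp [star_eq_adjoint, adjoint_inner_left, PiLp.inner_apply]

@[simp]
theorem diagonalOperator_apply {ι : Type*} [Fintype ι] (A : H →L[ℂ] H)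
    (x : PiLp 2 (fun _ : ι => H)) (i : ι) : diagonalOperator H ι A x i = A (x i) := rfl

/-- The embedding of `H` as the coordinate `i` of a finite direct sum of copies of `H`. -/
noncomputable def coordinateEmbedding (H : Type*) [NormedAddCommGroup H] [InnerProductSpace ℂ H]
    {ι : Type*} [Fintype ι] [DecidableEq ι] (i : ι) : H →ₗᵢ[ℂ] PiLp 2 (fun _ : ι => H) where
  toFun x := PiLp.single (β := fun _ => H) 2 i x
  map_add' x y := PiLp.single_add 2 i
  map_smul' c x := by simp [← PiLp.toLp_single, Pi.single_smul]
  norm_map' x := PiLp.norm_single 2 (fun _ : ι => H) i x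

theorem coordinateEmbedding_apply {H ι : Type*} [NormedAddCommGroup H] [InnerProductSpace ℂ H]
    [Fintype ι] [DecidableEq ι] (i : ι) (x : H) :
    coordinateEmbedding H i x = PiLp.single (β := fun _ => H) 2 i x := rfl

theorem adjoint_coordinateEmbedding_apply {ι : Type*} [Fintype ι] [DecidableEq ι] (i : ι)
    (x : PiLp 2 (fun _ : ι => H)) :
    adjoint (coordinateEmbedding H i).toContinuousLinearMap x = x i := by
  refine ext_inner_right ℂ fun y => ?_
  rw [adjoint_inner_left, PiLp.inner_apply, Finset.sum_eq_single i]
  · simp [coordinateEmbedding_apply]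
  · intro j _ hj
    simp [coordinateEmbedding_apply, hj]
  · simp

theorem diagonalOperator_coordinateEmbedding {ι : Type*} [Fintype ι] [DecidableEq ι] (i : ι)
    (A : H →L[ℂ] H) (x : H) :
    diagonalOperator H ι A (coordinateEmbedding H i x) = coordinateEmbedding H i (A x) := by
  ext j
  obtain rfl | hj := eq_or_ne j i <;> simp_all [coordinateEmbedding_apply]

/-- The operator `(x₀, …, x_{M+1}) ↦ (t x₀ + e x_{M+1}, d x₀ - t* x_{M+1}, x₁, …, x_M)`. -/
noncomputable def egervaryOperator (M : ℕ) (t d e : H →L[ℂ] H) :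
    PiLp 2 (fun _ : Fin (M + 2) => H) →L[ℂ] PiLp 2 (fun _ : Fin (M + 2) => H) :=
  LinearMap.toContinuousLinearMap
    { toFun := fun x => WithLp.toLp 2 (Fin.cons (t (x 0) + e (x (Fin.last _)))
        (Fin.cons (d (x 0) - adjoint t (x (Fin.last _))) fun l : Fin M => x l.succ.castSucc))
      map_add' := fun x y => by
        ext i
        refine Fin.cases ?_ (fun i => Fin.cases ?_ (fun l => ?_) i) i
        · simp; abel
        · simp; abel
        · simp
      map_smul' := fun c x => by
        ext i
        refine Fin.cases ?_ (fun i => Fin.cases ?_ (fun l => ?_) i) i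
        · simp
        · simp [smul_sub]
        · simp }

section Egervary

variable {M : ℕ} {t d e : H →L[ℂ] H}

@[simp]
theorem egervaryOperator_apply_zero (x : PiLp 2 (fun _ : Fin (M + 2) => H)) :
    egervaryOperator M t d e x 0 = t (x 0) + e (x (Fin.last _)) := rfl

@[simp]
theorem egervaryOperator_apply_one (x : PiLp 2 (fun _ : Fin (M + 2) => H)) :
    egervaryOperator M t d e x (Fin.succ 0) = d (x 0) - adjoint t (x (Fin.last _)) := rfl

@[simp]
theorem egervaryOperator_apply_succ_succ (x : PiLp 2 (fun _ : Fin (M + 2) => H)) (l : Fin M) :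
    egervaryOperator M t d e x l.succ.succ = x l.succ.castSucc := rfl

theorem commute_diagonalOperator_egervaryOperator {s : H →L[ℂ] H} (ht : Commute s t)
    (ht' : Commute s (star t)) (hd : Commute s d) (he : Commute s e) :
    Commute (diagonalOperator H (Fin (M + 2)) s) (egervaryOperator M t d e) := by
  have key : ∀ {a b : H →L[ℂ] H}, Commute a b → ∀ x, a (b x) = b (a x) :=
    fun h x => congrArg (fun f : H →L[ℂ] H => f x) h.eq
  refine ContinuousLinearMap.ext fun x => ?_
  ext i
  refine Fin.cases ?_ (fun i => Fin.cases ?_ (fun l => ?_) i) i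
  · simp [key ht, key he]
  · have := key ht'
    rw [star_eq_adjoint] at this
    simp only [mul_apply_eq_comp, diagonalOperator_apply, egervaryOperator_apply_one, map_sub, key hd,
      this]
  · simp only [mul_apply_eq_comp, diagonalOperator_apply, egervaryOperator_apply_succ_succ]

theorem egervaryOperator_mem_unitary (hd : star d = d) (he : star e = e)
    (hdd : d * d = 1 - star t * t) (hee : e * e = 1 - t * star t) (het : e * t = t * d) :
    egervaryOperator M t d e ∈ unitary _ := by
  rw [star_eq_adjoint] at hd he hdd hee
  have hinner : ∀ a b : H, ‖t a + e b‖ ^ 2 + ‖d a - adjoint t b‖ ^ 2 = ‖a‖ ^ 2 + ‖b‖ ^ 2 := by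
    intro a b
    have h1 : ‖t a‖ ^ 2 + ‖d a‖ ^ 2 = ‖a‖ ^ 2 := by
      have h := congrArg (fun f : H →L[ℂ] H => RCLike.re (inner ℂ (f a) a)) hdd
      simp only [mul_apply_eq_comp, sub_apply, one_apply_eq_self, inner_sub_left, map_sub,
        adjoint_inner_left] at h
      nth_rewrite 1 [← hd] at h
      rw [adjoint_inner_left, ← norm_sq_eq_re_inner, ← norm_sq_eq_re_inner,
        ← norm_sq_eq_re_inner] at h
      linarith
    have h2 : ‖e b‖ ^ 2 + ‖adjoint t b‖ ^ 2 = ‖b‖ ^ 2 := by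
      have h := congrArg (fun f : H →L[ℂ] H => RCLike.re (inner ℂ (f b) b)) hee
      simp only [mul_apply_eq_comp, sub_apply, one_apply_eq_self, inner_sub_left, map_sub] at h
      nth_rewrite 1 [← he] at h
      rw [adjoint_inner_left, ← adjoint_inner_right t, ← norm_sq_eq_re_inner,
        ← norm_sq_eq_re_inner, ← norm_sq_eq_re_inner] at h
      linarith
    have h3 : inner ℂ (t a) (e b) = inner ℂ (d a) (adjoint t b) := by
      rw [adjoint_inner_right, ← mul_apply_eq_comp, ← het, mul_apply_eq_comp, ← adjoint_inner_right e,
        he]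
    rw [@norm_add_sq ℂ, @norm_sub_sq ℂ, h3]
    linarith
  have hnorm : ∀ x, ‖egervaryOperator M t d e x‖ = ‖x‖ := by
    intro x
    rw [← sq_eq_sq₀ (norm_nonneg _) (norm_nonneg _), PiLp.norm_sq_eq_of_L2,
      PiLp.norm_sq_eq_of_L2, Fin.sum_univ_succ, Fin.sum_univ_succ, Fin.sum_univ_castSucc,
      Fin.sum_univ_succ]
    simp only [egervaryOperator_apply_zero, egervaryOperator_apply_one,
      egervaryOperator_apply_succ_succ, Fin.castSucc_zero]
    linarith [hinner (x 0) (x (Fin.last _))]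
  have hstar : star (egervaryOperator M t d e) * egervaryOperator M t d e = 1 :=
    (egervaryOperator M t d e).norm_map_iff_adjoint_comp_self.mp hnorm
  have hstar' : egervaryOperator M t d e * star (egervaryOperator M t d e) = 1 :=
    ContinuousLinearMap.coe_injective (_root_.mul_eq_one_comm.mp
      (congrArg ContinuousLinearMap.toLinearMap hstar))
  exact Unitary.mem_iff.mpr ⟨hstar, hstar'⟩

theorem egervaryOperator_pow_coordinateEmbedding (h : H) {m : ℕ} (hm : m ≤ M + 1) :
    (egervaryOperator M t d e ^ m) (coordinateEmbedding H 0 h) 0 = (t ^ m) h ∧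
      ∀ i : Fin (M + 2), m < i →
        (egervaryOperator M t d e ^ m) (coordinateEmbedding H 0 h) i = 0 := by
  induction m with
  | zero =>
    refine ⟨by simp [coordinateEmbedding_apply], fun i hi => ?_⟩
    have : i ≠ 0 := by rintro rfl; simp at hi
    simp [coordinateEmbedding_apply, this]
  | succ m ih =>
    obtain ⟨ih0, ih⟩ := ih (by omega)
    have hlast := ih (Fin.last _) (by simp; omega)
    rw [pow_succ', pow_succ', mul_apply_eq_comp, mul_apply_eq_comp]
    refine ⟨by rw [egervaryOperator_apply_zero, ih0, hlast, map_zero, add_zero], fun i => ?_⟩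
    refine Fin.cases ?_ (fun i => Fin.cases ?_ (fun l => ?_) i) i
    · simp
    · simp
    · intro hl
      rw [egervaryOperator_apply_succ_succ]
      exact ih _ (by simp at hl ⊢; omega)

end Egervary


/-- A doubly commuting family of contractions whose members with index in `s` are unitary. -/
structure IsDoublyCommutingFamily {ι : Type*} (s : Finset ι) (T : ι → (H →L[ℂ] H)) : Prop where
  norm_le_one : ∀ i, ‖T i‖ ≤ 1
  commute : ∀ i j, i ≠ j → Commute (T i) (T j)
  commute_star : ∀ i j, i ≠ j → Commute (T i) (star (T j))
  mem_unitary : ∀ i ∈ s, T i ∈ unitary (H →L[ℂ] H)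

namespace IsDoublyCommutingFamily

variable {ι : Type*} {s : Finset ι} {T : ι → (H →L[ℂ] H)}

theorem pairwise_commute_pow (hT : IsDoublyCommutingFamily s T) (m : ι → ℕ) (u : Set ι) :
    u.Pairwise (Function.onFun Commute fun i => T i ^ m i) :=
  fun i _ j _ hij => (hT.commute i j hij).pow_pow (m i) (m j)

/-- The product of the powers `T i ^ m i` of the members of a doubly commuting family. -/
noncomputable def monomial [Fintype ι] (hT : IsDoublyCommutingFamily s T) (m : ι → ℕ) :
    H →L[ℂ] H :=
  Finset.univ.noncommProd (fun i => T i ^ m i) (hT.pairwise_commute_pow m _)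

theorem monomial_eq_pow_mul [Fintype ι] [DecidableEq ι] (hT : IsDoublyCommutingFamily s T)
    (m : ι → ℕ) (j : ι) :
    hT.monomial m = T j ^ m j * (Finset.univ.erase j).noncommProd (fun i => T i ^ m i)
      (hT.pairwise_commute_pow m _) :=
  (Finset.mul_noncommProd_erase Finset.univ (Finset.mem_univ j) _ _ _).symm

end IsDoublyCommutingFamily

theorem noncommProd_apply_of_intertwining {H K ι : Type*} [NormedAddCommGroup H]
    [InnerProductSpace ℂ H] [NormedAddCommGroup K] [InnerProductSpace ℂ K] (E : H → K) (s : Finset ι) (S : ι → (K →L[ℂ] K))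
    (T : ι → (H →L[ℂ] H)) (hST : ∀ i ∈ s, ∀ x, S i (E x) = E (T i x)) (hS hT) (x : H) :
    s.noncommProd S hS (E x) = E (s.noncommProd T hT x) := by
  classical
  induction s using Finset.induction_on with
  | empty => simp
  | insert a s ha ih =>
    rw [Finset.noncommProd_insert_of_notMem _ _ _ _ ha,
      Finset.noncommProd_insert_of_notMem _ _ _ _ ha, mul_apply_eq_comp, mul_apply_eq_comp,
      ih (fun i hi => hST i (Finset.mem_insert_of_mem hi)), hST a (Finset.mem_insert_self a s)]

theorem pow_apply_of_intertwining {H K : Type*} [NormedAddCommGroup H] [InnerProductSpace ℂ H]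
    [NormedAddCommGroup K] [InnerProductSpace ℂ K] (E : H → K) (S : K →L[ℂ] K) (T : H →L[ℂ] H) (hST : ∀ x, S (E x) = E (T x)) (m : ℕ) (x : H) :
    (S ^ m) (E x) = E ((T ^ m) x) := by
  induction m with
  | zero => simp
  | succ m ih => rw [pow_succ', pow_succ', mul_apply_eq_comp, mul_apply_eq_comp, ih, hST]

/-- Dilating the member `j` of a doubly commuting family to a unitary, while every other member
acts diagonally. -/
theorem IsDoublyCommutingFamily.exists_dilation {ι : Type*} [Fintype ι] [DecidableEq ι]
    {s : Finset ι} {T : ι → (H →L[ℂ] H)} (hT : IsDoublyCommutingFamily s T) (j : ι) (M : ℕ) :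
    ∃ (S : ι → (PiLp 2 (fun _ : Fin (M + 2) => H) →L[ℂ] PiLp 2 (fun _ : Fin (M + 2) => H)))
      (hS : IsDoublyCommutingFamily (insert j s) S),
      ∀ m : ι → ℕ, (∀ i, m i ≤ M + 1) → ∀ h : H,
        adjoint (coordinateEmbedding H (0 : Fin (M + 2))).toContinuousLinearMap
          (hS.monomial m (coordinateEmbedding H 0 h)) =
        hT.monomial m h := by
  obtain ⟨d, e, hd, he, hdd, hee, het, hde⟩ := exists_defects (hT.norm_le_one j)
  let U := egervaryOperator M (T j) d e
  let D := diagonalOperator H (Fin (M + 2))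
  have hU : U ∈ unitary _ := egervaryOperator_mem_unitary hd he hdd hee het
  have hDU : ∀ i ≠ j, Commute (D (T i)) U := fun i hi =>
    have h := hde _ (hT.commute i j hi) (hT.commute_star i j hi)
    commute_diagonalOperator_egervaryOperator (hT.commute i j hi) (hT.commute_star i j hi) h.1 h.2
  have hDU' : ∀ i ≠ j, Commute (star (D (T i))) U := fun i hi => by
    have h1 : Commute (star (T i)) (T j) := (hT.commute_star j i hi.symm).symm
    have h2 : Commute (star (T i)) (star (T j)) := (hT.commute i j hi).star_star
    rw [← map_star]
    exact commute_diagonalOperator_egervaryOperator h1 h2 (hde _ h1 h2).1 (hde _ h1 h2).2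
  let S : ι → _ := Function.update (fun i => D (T i)) j U
  have hSj : S j = U := Function.update_self ..
  have hSi : ∀ i ≠ j, S i = D (T i) := fun i hi => Function.update_of_ne hi ..
  have hS : IsDoublyCommutingFamily (insert j s) S := by
    refine ⟨fun i => ?_, fun i l hil => ?_, fun i l hil => ?_, fun i hi => ?_⟩
    · obtain rfl | hi := eq_or_ne i j
      · rw [hSj]
        exact opNorm_le_bound _ zero_le_one fun x => by
          rw [norm_map_of_mem_unitary hU, one_mul]
      · rw [hSi i hi]
        exact (NonUnitalStarAlgHom.norm_apply_le D (T i)).trans (hT.norm_le_one i)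
    · obtain rfl | hi := eq_or_ne i j
      · rw [hSj, hSi l hil.symm]
        exact (hDU l hil.symm).symm
      · obtain rfl | hl := eq_or_ne l j
        · rw [hSj, hSi i hi]
          exact hDU i hi
        · rw [hSi i hi, hSi l hl]
          exact (hT.commute i l hil).map D
    · obtain rfl | hi := eq_or_ne i j
      · rw [hSj, hSi l hil.symm]
        exact (hDU' l hil.symm).symm
      · obtain rfl | hl := eq_or_ne l j
        · rw [hSj, hSi i hi]
          simpa using (hDU' i hi).star_star
        · rw [hSi i hi, hSi l hl, ← map_star]
          exact (hT.commute_star i l hil).map D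
    · obtain rfl | hij := eq_or_ne i j
      · rwa [hSj]
      · rw [hSi i hij]
        exact Unitary.map_mem D (hT.mem_unitary i (Finset.mem_of_mem_insert_of_ne hi hij))
  refine ⟨S, hS, fun m hm h => ?_⟩
  have hrest := noncommProd_apply_of_intertwining (coordinateEmbedding H (0 : Fin (M + 2)))
    (Finset.univ.erase j) (fun i => S i ^ m i) (fun i => T i ^ m i) (fun i hi x => ?_)
    (hS.pairwise_commute_pow m _) (hT.pairwise_commute_pow m _) h
  · rw [hS.monomial_eq_pow_mul m j, hT.monomial_eq_pow_mul m j, mul_apply_eq_comp,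
      mul_apply_eq_comp, hrest, hSj, adjoint_coordinateEmbedding_apply]
    exact (egervaryOperator_pow_coordinateEmbedding _ (hm j)).1
  · rw [hSi i (Finset.ne_of_mem_erase hi)]
    exact pow_apply_of_intertwining _ _ _ (diagonalOperator_coordinateEmbedding 0 (T i)) _ _

end Dilation

theorem IsDoublyCommutingFamily.exists_unitary_dilation {H ι : Type} [NormedAddCommGroup H]
    [InnerProductSpace ℂ H] [FiniteDimensional ℂ H] [Fintype ι] [DecidableEq ι]
    {T : ι → (H →L[ℂ] H)} (hT : IsDoublyCommutingFamily ∅ T) (M : ℕ) (s : Finset ι) :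
    ∃ (K : Type) (_ : NormedAddCommGroup K) (_ : InnerProductSpace ℂ K)
      (_ : FiniteDimensional ℂ K) (W : H →ₗᵢ[ℂ] K) (S : ι → (K →L[ℂ] K))
      (hS : IsDoublyCommutingFamily s S),
      Module.finrank ℂ K = (M + 2) ^ s.card * Module.finrank ℂ H ∧
      ∀ m : ι → ℕ, (∀ i, m i ≤ M + 1) → ∀ h : H,
        adjoint W.toContinuousLinearMap
          (hS.monomial m (W h)) =
        hT.monomial m h := by
  induction s using Finset.induction_on with
  | empty =>
    refine ⟨H, inferInstance, inferInstance, inferInstance, LinearIsometry.id, T, hT, by simp,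
      fun m _ h => ?_⟩
    exact adjoint_linearIsometry_apply_self LinearIsometry.id (hT.monomial m h)
  | insert j s hj ih =>
    obtain ⟨K, _, _, _, W, S, hS, hK, hW⟩ := ih
    obtain ⟨S', hS', hW'⟩ := hS.exists_dilation j M
    refine ⟨PiLp 2 (fun _ : Fin (M + 2) => K), inferInstance, inferInstance, inferInstance,
      (coordinateEmbedding K 0).comp W, S', hS', ?_, fun m hm h => ?_⟩
    · rw [(WithLp.linearEquiv 2 ℂ (Fin (M + 2) → K)).finrank_eq, Module.finrank_pi_fintype,
        Finset.sum_const, Finset.card_univ, Fintype.card_fin, hK, Finset.card_insert_of_notMem hj,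
        smul_eq_mul, pow_succ', mul_assoc]
    · rw [adjoint_linearIsometry_comp_apply]
      exact (congrArg _ (hW' m hm (W h))).trans (hW m hm h)

/-- **Dilation of doubly commuting tuples.** Let `T₁, …, T_k` be doubly commuting
contractions on an `n`-dimensional complex Hilbert space `H`. Then for every `N` there
exist commuting unitaries `U₁, …, U_k` on a Hilbert space `K ⊇ H` of dimension
`(N+1)^k · n` such that `T₁^{m₁} ⋯ T_k^{m_k} = P_H U₁^{m₁} ⋯ U_k^{m_k} P_H` whenever
`m₁ + ⋯ + m_k ≤ N`. -/
theorem doubly_commuting_N_dilation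
    (H : Type) [NormedAddCommGroup H] [InnerProductSpace ℂ H] [FiniteDimensional ℂ H]
    (n : ℕ) (hn : Module.finrank ℂ H = n)
    (k : ℕ) (T : Fin k → (H →L[ℂ] H)) (hT : ∀ i, ‖T i‖ ≤ 1)
    (hcomm : ∀ i j, i ≠ j → Commute (T i) (T j))
    (hdcomm : ∀ i j, i ≠ j → Commute (T i) (adjoint (T j)))
    (N : ℕ) :
    ∃ (W : H →ₗᵢ[ℂ] EuclideanSpace ℂ (Fin ((N + 1) ^ k * n)))
      (U : Fin k → (EuclideanSpace ℂ (Fin ((N + 1) ^ k * n)) →L[ℂ]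
                    EuclideanSpace ℂ (Fin ((N + 1) ^ k * n))))
      (hUcomm : ∀ i j, Commute (U i) (U j)),
      (∀ i, U i ∈ unitary _) ∧
      ∀ m : Fin k → ℕ, (∑ i, m i) ≤ N →
        ∀ h : H,
          adjoint W.toContinuousLinearMap
            ((Finset.univ.noncommProd (fun i => (U i) ^ (m i))
                (fun i _ j _ _ => (hUcomm i j).pow_pow (m i) (m j))) (W h)) =
          (Finset.univ.noncommProd (fun i => (T i) ^ (m i))
              (fun i _ j _ hij => ((hcomm i j hij).pow_pow (m i) (m j)))) h := by
  classical
  subst hn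
  cases N with
  | zero =>
    obtain ⟨e⟩ : Nonempty (H ≃ₗᵢ[ℂ] EuclideanSpace ℂ (Fin ((0 + 1) ^ k * Module.finrank ℂ H))) :=
      ⟨((stdOrthonormalBasis ℂ H).reindex (finCongr (by simp))).repr⟩
    refine ⟨e.toLinearIsometry, fun _ => 1, fun _ _ => Commute.refl 1, fun _ => one_mem _,
      fun m hm h => ?_⟩
    have hm0 : ∀ i, m i = 0 := by simpa using hm
    refine (congrArg _ (noncommProd_apply_of_intertwining e.toLinearIsometry Finset.univ _
      (fun i => T i ^ m i) (fun i _ x => ?_) _ _ h)).trans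
      (adjoint_linearIsometry_apply_self _ _)
    simp [hm0]
  | succ M =>
    have hT' : IsDoublyCommutingFamily ∅ T := ⟨hT, hcomm, hdcomm, by simp⟩
    obtain ⟨K, _, _, _, W, S, hS, hK, hW⟩ := hT'.exists_unitary_dilation M Finset.univ
    obtain ⟨e⟩ : Nonempty
        (K ≃ₗᵢ[ℂ] EuclideanSpace ℂ (Fin ((M + 1 + 1) ^ k * Module.finrank ℂ H))) :=
      ⟨((stdOrthonormalBasis ℂ K).reindex (finCongr (by simp [hK]))).repr⟩
    have hScomm : ∀ i j, Commute (S i) (S j) := fun i j => by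
      obtain rfl | hij := eq_or_ne i j
      · exact Commute.refl _
      · exact hS.commute i j hij
    refine ⟨e.toLinearIsometry.comp W, fun i => e.conjStarAlgEquiv (S i),
      fun i j => (hScomm i j).map e.conjStarAlgEquiv,
      fun i => Unitary.map_mem e.conjStarAlgEquiv (hS.mem_unitary i (Finset.mem_univ i)),
      fun m hm h => ?_⟩
    have hm' : ∀ i, m i ≤ M + 1 := fun i =>
      (Finset.single_le_sum (fun _ _ => Nat.zero_le _) (Finset.mem_univ i)).trans hm
    rw [adjoint_linearIsometry_comp_apply]
    refine (congrArg _ ?_).trans (hW m hm' h)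
    refine (congrArg _ (noncommProd_apply_of_intertwining e.toLinearIsometry Finset.univ _
      (fun i => S i ^ m i) (fun i _ x => ?_) _ (hS.pairwise_commute_pow m _) (W h))).trans
      (adjoint_linearIsometry_apply_self e.toLinearIsometry (hS.monomial m (W h)))
    exact pow_apply_of_intertwining e.toLinearIsometry (e.conjStarAlgEquiv (S i)) (S i)
      (fun x => by simp) (m i) x
end
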